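/- Let H be a complex Hilbert space, A, B : ℝ → B(H) strongly continuous with A(t)* = A(t) for all t. Then for any t₀ ∈ ℝ and f₀ ∈ B(H), the initial value problem f'(t) = i[A(t), f(t)] + B(t), f(t₀) = f₀ (in the strong sense) has a unique strong solution f : ℝ → B(H), given explicitly by f(t) = U(t,t₀) ( f₀ + ∫_{t₀}^t U(s,t₀)* B(s) U(s,t₀) ds ) U(t,t₀)*, where U(t,t₀) is the unitary propagator generated by −A(t). This solution satisfies the norm bound ‖f(t)‖ ≤ ‖f₀‖ + ∫_{t₋}^{t₊} ‖B(s)‖ ds, where t₊ = max{t, t₀} and t₋ = min{t, t₀}. -/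

import Mathlib

open Filter Topology MeasureTheory

section StrongTopology

variable {E F : Type*} [NormedAddCommGroup E] [NormedSpace ℂ E]
  [NormedAddCommGroup F] [NormedSpace ℂ F]

/-- A locally bounded, strongly convergent family of operators is jointly continuous. -/
theorem tendsto_clm_apply_of_bounded {ι : Type*} {l : Filter ι} {T : ι → E →L[ℂ] F}
    {x : ι → E} {x₀ : E} {y : F} {C : ℝ} (hC : ∀ᶠ s in l, ‖T s‖ ≤ C)
    (hT : Tendsto (fun s => T s x₀) l (𝓝 y)) (hx : Tendsto x l (𝓝 x₀)) :
    Tendsto (fun s => T s (x s)) l (𝓝 y) := by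
  have h₀ : Tendsto (fun s => T s (x s - x₀)) l (𝓝 0) := by
    have hx' : Tendsto (fun s => C * ‖x s - x₀‖) l (𝓝 0) := by
      have := (tendsto_iff_norm_sub_tendsto_zero.1 hx).const_mul C
      simpa using this
    refine squeeze_zero_norm' ?_ hx'
    filter_upwards [hC] with s hs
    exact (T s).le_of_opNorm_le hs _
  simpa using h₀.add hT

/-- Banach-Steinhaus: a strongly continuous family is bounded on compact sets. -/
theorem exists_norm_le_of_strongly_continuous [CompleteSpace E] {T : ℝ → E →L[ℂ] F}
    (hT : ∀ ψ, Continuous fun t => T t ψ) {K : Set ℝ} (hK : IsCompact K) :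
    ∃ C, ∀ t ∈ K, ‖T t‖ ≤ C := by
  obtain ⟨C, hC⟩ := banach_steinhaus (g := fun t : K => T t) fun ψ => by
    obtain ⟨C, hC⟩ := hK.exists_bound_of_continuousOn (hT ψ).continuousOn
    exact ⟨C, fun t => hC t t.2⟩
  exact ⟨C, fun t ht => hC ⟨t, ht⟩⟩

theorem eventually_norm_le_of_strongly_continuous [CompleteSpace E] {T : ℝ → E →L[ℂ] F}
    (hT : ∀ ψ, Continuous fun t => T t ψ) (t : ℝ) :
    ∃ C, ∀ᶠ s in 𝓝 t, ‖T s‖ ≤ C := by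
  obtain ⟨C, hC⟩ := exists_norm_le_of_strongly_continuous hT (isCompact_closedBall t 1)
  exact ⟨C, Filter.mem_of_superset (Metric.closedBall_mem_nhds t one_pos) hC⟩

theorem continuous_apply_of_strongly_continuous [CompleteSpace E] {T : ℝ → E →L[ℂ] F}
    (hT : ∀ ψ, Continuous fun t => T t ψ) {x : ℝ → E} (hx : Continuous x) :
    Continuous fun t => T t (x t) := by
  refine continuous_iff_continuousAt.2 fun t => ?_
  obtain ⟨C, hC⟩ := eventually_norm_le_of_strongly_continuous hT t
  exact tendsto_clm_apply_of_bounded hC (hT (x t)).continuousAt hx.continuousAt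

/-- Product rule for a strongly continuous family that is differentiable at the base vector. -/
theorem hasDerivAt_apply_of_strongly_continuous [CompleteSpace E] {T : ℝ → E →L[ℂ] F}
    (hT : ∀ ψ, Continuous fun t => T t ψ) {x : ℝ → E} {t : ℝ} {x' : E} {y : F}
    (hTx : HasDerivAt (fun s => T s (x t)) y t) (hx : HasDerivAt x x' t) :
    HasDerivAt (fun s => T s (x s)) (y + T t x') t := by
  obtain ⟨C, hC⟩ := eventually_norm_le_of_strongly_continuous hT t
  rw [hasDerivAt_iff_tendsto_slope] at *
  have h := tendsto_clm_apply_of_bounded (hC.filter_mono nhdsWithin_le_nhds)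
    ((hT x').continuousAt.tendsto.mono_left nhdsWithin_le_nhds) hx
  refine (hTx.add h).congr fun s => ?_
  have hr : ∀ (r : ℝ) (v : E), T s (r • v) = r • T s v := fun r v =>
    map_real_smul (T s) (T s).continuous r v
  simp only [slope, vsub_eq_sub, hr, map_sub, ← smul_add]
  congr 1
  abel

/-- The operator norm of a strongly continuous family is locally integrable, being lower
semicontinuous and locally bounded. -/
theorem intervalIntegrable_norm_of_strongly_continuous [CompleteSpace E] {T : ℝ → E →L[ℂ] F}
    (hT : ∀ ψ, Continuous fun t => T t ψ) (a b : ℝ) :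
    IntervalIntegrable (fun t => ‖T t‖) volume a b := by
  have hlsc : LowerSemicontinuous fun t => ‖T t‖ := by
    refine lowerSemicontinuous_iff_isClosed_preimage.2 fun r => ?_
    rcases lt_or_ge r 0 with hr | hr
    · convert isClosed_empty
      ext t
      simpa using hr.trans_le (norm_nonneg (T t))
    · have : (fun t => ‖T t‖) ⁻¹' Set.Iic r = ⋂ ψ, {t | ‖T t ψ‖ ≤ r * ‖ψ‖} := by
        ext t
        simp [ContinuousLinearMap.opNorm_le_iff hr]
      rw [this]
      exact isClosed_iInter fun ψ => isClosed_le (hT ψ).norm continuous_const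
  obtain ⟨C, hC⟩ := exists_norm_le_of_strongly_continuous hT (isCompact_uIcc (a := a) (b := b))
  refine (intervalIntegrable_const (c := C)).mono_fun
    hlsc.measurable.aestronglyMeasurable ?_
  refine (ae_restrict_iff' measurableSet_uIoc).2 (ae_of_all _ fun t ht => ?_)
  simp only [norm_norm]
  exact (hC t (Set.uIoc_subset_uIcc ht)).trans (le_abs_self C)

/-- The strong integral of a strongly continuous family of operators. -/
noncomputable def strongIntegral [CompleteSpace E] {T : ℝ → E →L[ℂ] F}
    (hT : ∀ ψ, Continuous fun t => T t ψ) (a b : ℝ) : E →L[ℂ] F :=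
  LinearMap.mkContinuousOfExistsBound
    { toFun := fun ψ => ∫ s in a..b, T s ψ
      map_add' := fun φ ψ => by
        simp only [map_add]
        exact intervalIntegral.integral_add ((hT φ).intervalIntegrable _ _)
          ((hT ψ).intervalIntegrable _ _)
      map_smul' := fun c ψ => by
        simp only [map_smul, intervalIntegral.integral_smul, RingHom.id_apply] } <| by
    obtain ⟨C, hC⟩ := exists_norm_le_of_strongly_continuous hT
      (isCompact_uIcc (a := a) (b := b))
    refine ⟨C * |b - a|, fun ψ => ?_⟩
    refine (intervalIntegral.norm_integral_le_of_norm_le_const fun s hs =>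
      (T s).le_of_opNorm_le (hC s (Set.uIoc_subset_uIcc hs)) ψ).trans_eq ?_
    ring

theorem strongIntegral_apply [CompleteSpace E] {T : ℝ → E →L[ℂ] F}
    (hT : ∀ ψ, Continuous fun t => T t ψ) (a b : ℝ) (ψ : E) :
    strongIntegral hT a b ψ = ∫ s in a..b, T s ψ := rfl

end StrongTopology

section Propagator

variable {H : Type*} [NormedAddCommGroup H] [InnerProductSpace ℂ H] [CompleteSpace H]

theorem norm_apply_of_adjoint_mul_self {V : H →L[ℂ] H}
    (hV : ContinuousLinearMap.adjoint V * V = 1) (ψ : H) : ‖V ψ‖ = ‖ψ‖ :=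
  (ContinuousLinearMap.norm_map_iff_adjoint_comp_self V).2 hV ψ

/-- The adjoint of a unitary family satisfies the adjoint evolution equation. -/
theorem hasDerivAt_adjoint_of_unitary {U D : ℝ → H →L[ℂ] H}
    (hU : ∀ t, ContinuousLinearMap.adjoint (U t) * U t = 1 ∧
      U t * ContinuousLinearMap.adjoint (U t) = 1)
    (hD : ∀ ψ t, HasDerivAt (fun s => U s ψ) (D t (U t ψ)) t) (ψ : H) (t : ℝ) :
    HasDerivAt (fun s => ContinuousLinearMap.adjoint (U s) ψ)
      (-ContinuousLinearMap.adjoint (U t) (D t ψ)) t := by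
  have hVU : ∀ s φ, ContinuousLinearMap.adjoint (U s) (U s φ) = φ := fun s φ =>
    DFunLike.congr_fun (hU s).1 φ
  have hUV : ∀ s φ, U s (ContinuousLinearMap.adjoint (U s) φ) = φ := fun s φ =>
    DFunLike.congr_fun (hU s).2 φ
  have hbound : ∀ s, ‖ContinuousLinearMap.adjoint (U s)‖ ≤ 1 := fun s =>
    ContinuousLinearMap.opNorm_le_bound _ zero_le_one fun φ => by
      rw [norm_apply_of_adjoint_mul_self (by simpa using (hU s).2), one_mul]
  have key : ∀ s φ, ContinuousLinearMap.adjoint (U s) φ =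
      ContinuousLinearMap.adjoint (U t) φ - ContinuousLinearMap.adjoint (U s)
        (U s (ContinuousLinearMap.adjoint (U t) φ) - φ) := fun s φ => by
    rw [map_sub, hVU]; abel
  have hcont : ∀ φ, Tendsto (fun s => ContinuousLinearMap.adjoint (U s) φ) (𝓝 t)
      (𝓝 (ContinuousLinearMap.adjoint (U t) φ)) := fun φ => by
    have h : Tendsto (fun s => U s (ContinuousLinearMap.adjoint (U t) φ) - φ) (𝓝 t) (𝓝 0) := by
      have := (hD (ContinuousLinearMap.adjoint (U t) φ) t).continuousAt.tendsto.sub_const φ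
      rwa [hUV, sub_self] at this
    have h' := (tendsto_clm_apply_of_bounded (T := fun s => ContinuousLinearMap.adjoint (U s))
      (y := 0) (Eventually.of_forall hbound) (by simp) h).const_sub
        (ContinuousLinearMap.adjoint (U t) φ)
    rw [sub_zero] at h'
    exact h'.congr fun s => (key s φ).symm
  have hd := hD (ContinuousLinearMap.adjoint (U t) ψ) t
  rw [hasDerivAt_iff_tendsto_slope, hUV] at hd
  rw [hasDerivAt_iff_tendsto_slope]
  refine (tendsto_clm_apply_of_bounded (Eventually.of_forall hbound)
    ((hcont (D t ψ)).mono_left nhdsWithin_le_nhds) hd).neg.congr fun s => ?_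
  have hr : ∀ (r : ℝ) (v : H), ContinuousLinearMap.adjoint (U s) (r • v) =
      r • ContinuousLinearMap.adjoint (U s) v := fun r v =>
    map_real_smul _ (ContinuousLinearMap.adjoint (U s)).continuous r v
  simp only [slope, vsub_eq_sub, hr, map_sub, hVU, hUV, ← smul_neg]
  congr 1
  abel

end Propagator


/-- For strongly continuous `A`, `B` with each `A(t)` self-adjoint, the initial value problem
`f'(t) = i[A(t), f(t)] + B(t)`, `f(t₀) = f₀` has a unique strong solution, given explicitly in
terms of the unitary propagator `U` generated by `-A` (satisfying `i U'(t) = -A(t)U(t)`,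
`U(t₀) = 1`), and this solution satisfies
`‖f(t)‖ ≤ ‖f₀‖ + ∫_{t₋}^{t₊} ‖B(s)‖ ds`. -/
theorem stmt_10 {H : Type*} [NormedAddCommGroup H] [InnerProductSpace ℂ H] [CompleteSpace H]
    (A B : ℝ → H →L[ℂ] H)
    (hA : ∀ ψ : H, Continuous fun t => A t ψ)
    (hB : ∀ ψ : H, Continuous fun t => B t ψ)
    (hAsa : ∀ t : ℝ, ContinuousLinearMap.adjoint (A t) = A t)
    (t₀ : ℝ) (f₀ : H →L[ℂ] H)
    (U : ℝ → H →L[ℂ] H) (hU0 : U t₀ = 1)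
    (hUuni : ∀ t : ℝ, ContinuousLinearMap.adjoint (U t) * U t = 1 ∧
        U t * ContinuousLinearMap.adjoint (U t) = 1)
    (hUode : ∀ (ψ : H) (t : ℝ),
        HasDerivAt (fun s => U s ψ) (Complex.I • (A t (U t ψ))) t) :
    (∃! f : ℝ → H →L[ℂ] H, f t₀ = f₀ ∧
        ∀ (ψ : H) (t : ℝ), HasDerivAt (fun s => f s ψ)
          (Complex.I • ((A t * f t - f t * A t) ψ) + B t ψ) t) ∧
    ∀ f : ℝ → H →L[ℂ] H,
      (f t₀ = f₀ ∧ ∀ (ψ : H) (t : ℝ), HasDerivAt (fun s => f s ψ)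
          (Complex.I • ((A t * f t - f t * A t) ψ) + B t ψ) t) →
      (∀ (t : ℝ) (ψ : H), f t ψ =
          U t (f₀ (ContinuousLinearMap.adjoint (U t) ψ) +
            ∫ s in t₀..t, ContinuousLinearMap.adjoint (U s)
              (B s (U s (ContinuousLinearMap.adjoint (U t) ψ))))) ∧
      ∀ t : ℝ, ‖f t‖ ≤ ‖f₀‖ + ∫ s in min t t₀..max t t₀, ‖B s‖ := by
  have hmul : ∀ (S T : H →L[ℂ] H) (φ : H), (S * T) φ = S (T φ) := fun _ _ _ => rfl
  have hVU : ∀ s φ, ContinuousLinearMap.adjoint (U s) (U s φ) = φ := fun s φ =>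
    DFunLike.congr_fun (hUuni s).1 φ
  have hUV : ∀ s φ, U s (ContinuousLinearMap.adjoint (U s) φ) = φ := fun s φ =>
    DFunLike.congr_fun (hUuni s).2 φ
  have hnU : ∀ s φ, ‖U s φ‖ = ‖φ‖ := fun s =>
    norm_apply_of_adjoint_mul_self (hUuni s).1
  have hnV : ∀ s φ, ‖ContinuousLinearMap.adjoint (U s) φ‖ = ‖φ‖ := fun s =>
    norm_apply_of_adjoint_mul_self (by simpa using (hUuni s).2)
  have hVode : ∀ (ψ : H) (t : ℝ), HasDerivAt (fun s => ContinuousLinearMap.adjoint (U s) ψ)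
      (-ContinuousLinearMap.adjoint (U t) (Complex.I • A t ψ)) t := fun ψ t =>
    hasDerivAt_adjoint_of_unitary (D := fun t => Complex.I • A t) hUuni hUode ψ t
  have hUc : ∀ ψ, Continuous fun t => U t ψ := fun ψ =>
    continuous_iff_continuousAt.2 fun t => (hUode ψ t).continuousAt
  have hVc : ∀ ψ, Continuous fun t => ContinuousLinearMap.adjoint (U t) ψ := fun ψ =>
    continuous_iff_continuousAt.2 fun t => (hVode ψ t).continuousAt
  have hVBU : ∀ ψ, Continuous fun t => (ContinuousLinearMap.adjoint (U t) * B t * U t) ψ :=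
    fun ψ => continuous_apply_of_strongly_continuous hVc
      (continuous_apply_of_strongly_continuous hB (hUc ψ))
  have formula : ∀ f : ℝ → H →L[ℂ] H,
      (f t₀ = f₀ ∧ ∀ (ψ : H) (t : ℝ), HasDerivAt (fun s => f s ψ)
          (Complex.I • ((A t * f t - f t * A t) ψ) + B t ψ) t) →
      ∀ (t : ℝ) (ψ : H), f t ψ =
          U t (f₀ (ContinuousLinearMap.adjoint (U t) ψ) +
            ∫ s in t₀..t, ContinuousLinearMap.adjoint (U s)
              (B s (U s (ContinuousLinearMap.adjoint (U t) ψ)))) := by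
    rintro f ⟨hf0, hf⟩ t ψ
    have hfc : ∀ ψ, Continuous fun t => f t ψ := fun ψ =>
      continuous_iff_continuousAt.2 fun t => (hf ψ t).continuousAt
    have hint : ∀ φ, ∫ s in t₀..t, ContinuousLinearMap.adjoint (U s) (B s (U s φ)) =
        ContinuousLinearMap.adjoint (U t) (f t (U t φ)) - f₀ φ := fun φ => by
      have hderiv : ∀ s, HasDerivAt
          (fun r => ContinuousLinearMap.adjoint (U r) (f r (U r φ)))
          (ContinuousLinearMap.adjoint (U s) (B s (U s φ))) s := fun s => by
        refine (hasDerivAt_apply_of_strongly_continuous hVc (hVode _ s)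
          (hasDerivAt_apply_of_strongly_continuous hfc (hf _ s) (hUode φ s))).congr_deriv ?_
        simp only [map_add, map_sub, map_smul, sub_apply, hmul, smul_sub]
        abel
      rw [intervalIntegral.integral_eq_sub_of_hasDerivAt (fun s _ => hderiv s)
        ((hVBU φ).intervalIntegrable _ _), hU0, hf0]
      simp [← ContinuousLinearMap.star_eq_adjoint]
    rw [hint, hUV, add_sub_cancel, hUV]
  refine ⟨⟨fun t => U t * (f₀ + strongIntegral hVBU t₀ t) *
      ContinuousLinearMap.adjoint (U t), ⟨?_, fun ψ t => ?_⟩, fun g hg => ?_⟩,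
    fun f hf => ⟨formula f hf, fun t => ?_⟩⟩
  · ext ψ
    simp [hU0, strongIntegral_apply, ← ContinuousLinearMap.star_eq_adjoint]
  · have hGode : ∀ φ t, HasDerivAt (fun s => (f₀ + strongIntegral hVBU t₀ s) φ)
        (ContinuousLinearMap.adjoint (U t) (B t (U t φ))) t := fun φ t =>
      ((hVBU φ).integral_hasStrictDerivAt t₀ t).hasDerivAt.const_add (f₀ φ)
    have hGc : ∀ φ, Continuous fun s => (f₀ + strongIntegral hVBU t₀ s) φ := fun φ =>
      continuous_iff_continuousAt.2 fun t => (hGode φ t).continuousAt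
    refine (hasDerivAt_apply_of_strongly_continuous hUc (hUode _ t)
      (hasDerivAt_apply_of_strongly_continuous hGc (hGode _ t) (hVode ψ t))).congr_deriv ?_
    simp only [map_add, map_neg, map_smul, sub_apply, hmul, smul_sub, hUV]
    abel
  · ext t ψ
    rw [formula g hg t ψ]
    rfl
  · have hBi := intervalIntegrable_norm_of_strongly_continuous hB
    have hI : ∫ s in min t t₀..max t t₀, ‖B s‖ = |∫ s in t₀..t, ‖B s‖| := by
      rcases le_total t t₀ with h | h
      · rw [min_eq_left h, max_eq_right h, intervalIntegral.integral_symm t t₀, abs_neg,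
          abs_of_nonneg (intervalIntegral.integral_nonneg h fun s _ => norm_nonneg _)]
      · rw [min_eq_right h, max_eq_left h,
          abs_of_nonneg (intervalIntegral.integral_nonneg h fun s _ => norm_nonneg _)]
    rw [hI]
    refine ContinuousLinearMap.opNorm_le_bound _ (by positivity) fun ψ => ?_
    rw [formula f hf t ψ, hnU, add_mul]
    refine (norm_add_le _ _).trans (add_le_add ((f₀.le_opNorm _).trans_eq (by rw [hnV])) ?_)
    refine (intervalIntegral.norm_integral_le_abs_of_norm_le (ae_of_all _ fun s => ?_)
      ((hBi t₀ t).mul_const ‖ψ‖)).trans_eq ?_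
    · rw [hnV]
      exact ((B s).le_opNorm _).trans_eq (by rw [hnU, hnV])
    · rw [intervalIntegral.integral_mul_const, abs_mul, abs_norm]
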